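/- arXiv:1401.5544 — 3 statements merged into one kernel-verified Lean document; each statement's English description precedes it below -/
import Mathlib

section
/- Let α, β : ℝ → ℝ be continuously differentiable with α'(σ)² + β'(σ)² = 1 for all σ, let S : (0, π) → ℝ be differentiable and satisfy S'(φ)·sin φ = α(S(φ)) with α(S(φ)) > 0 for all φ ∈ (0, π), and define φ(p) = arccos((1 − |p|²)/(1 + |p|²)) for p ∈ ℝ². Define P : ℝ² \ {0} → ℝ³ by P(x, y) = ( α(S(φ(x,y))) cos θ(x,y), α(S(φ(x,y))) sin θ(x,y), β(S(φ(x,y))) ), where θ(x,y) is the polar angle of (x,y). Then P is conformal: at every p = (x,y) ≠ 0 the partial derivatives satisfy ⟨∂ₓP(p), ∂_yP(p)⟩ = 0 and |∂ₓP(p)|² = |∂_yP(p)|² = ( α(S(φ(p))) / |p| )², i.e. the pullback under P of the Euclidean metric of ℝ³ equals e^{2f}(dx² + dy²) with f(p) = ln( α(S(φ(p))) / |p| ). -/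
open Real

/-- The polar angle `φ(p) = arccos((1 - |p|²)/(1 + |p|²))` on the sphere obtained by
inverse stereographic projection of `p ∈ ℝ²`. -/
noncomputable def polarPhi (p : EuclideanSpace ℝ (Fin 2)) : ℝ :=
  Real.arccos ((1 - ‖p‖ ^ 2) / (1 + ‖p‖ ^ 2))

/-- A point of `ℝ³` (Euclidean). -/
noncomputable def e3 (x y z : ℝ) : EuclideanSpace ℝ (Fin 3) :=
  (WithLp.equiv 2 (Fin 3 → ℝ)).symm ![x, y, z]

/-- Half-angle form of the stereographic polar angle. -/
theorem polarPhi_eq_two_mul_arctan (p : EuclideanSpace ℝ (Fin 2)) :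
    polarPhi p = 2 * Real.arctan ‖p‖ := by
  have hcos : Real.cos (2 * Real.arctan ‖p‖) = (1 - ‖p‖ ^ 2) / (1 + ‖p‖ ^ 2) := by
    have h : (1 + ‖p‖ ^ 2) ≠ 0 := by positivity
    rw [Real.cos_two_mul, Real.cos_sq_arctan]
    field_simp
    ring
  rw [polarPhi, ← hcos, Real.arccos_cos]
  · have := Real.arctan_nonneg.2 (norm_nonneg p)
    linarith
  · have := Real.arctan_lt_pi_div_two ‖p‖
    linarith

theorem polarPhi_mem_Ioo {p : EuclideanSpace ℝ (Fin 2)} (hp : p ≠ 0) :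
    polarPhi p ∈ Set.Ioo (0 : ℝ) π := by
  rw [polarPhi_eq_two_mul_arctan]
  have h₁ := Real.arctan_pos.2 (norm_pos_iff.2 hp)
  have h₂ := Real.arctan_lt_pi_div_two ‖p‖
  constructor <;> linarith

theorem sin_polarPhi (p : EuclideanSpace ℝ (Fin 2)) :
    Real.sin (polarPhi p) = 2 * ‖p‖ / (1 + ‖p‖ ^ 2) := by
  have h : (1 + ‖p‖ ^ 2) ≠ 0 := by positivity
  have hc : Real.cos (Real.arctan ‖p‖) ≠ 0 := (Real.cos_arctan_pos _).ne'
  have ht : Real.sin (Real.arctan ‖p‖) = ‖p‖ * Real.cos (Real.arctan ‖p‖) := by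
    rw [← Real.tan_mul_cos hc, Real.tan_arctan]
  calc Real.sin (polarPhi p) = 2 * ‖p‖ * Real.cos (Real.arctan ‖p‖) ^ 2 := by
        rw [polarPhi_eq_two_mul_arctan, Real.sin_two_mul, ht]
        ring
    _ = 2 * ‖p‖ / (1 + ‖p‖ ^ 2) := by
        rw [Real.cos_sq_arctan]
        ring

theorem hasFDerivAt_norm_of_ne_zero {E : Type*} [NormedAddCommGroup E] [InnerProductSpace ℝ E]
    {p : E} (hp : p ≠ 0) : HasFDerivAt (fun q : E => ‖q‖) (‖p‖⁻¹ • innerSL ℝ p) p := by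
  have hr : ‖p‖ ≠ 0 := norm_ne_zero_iff.2 hp
  have h := (hasStrictFDerivAt_norm_sq p).hasFDerivAt.sqrt (pow_ne_zero 2 hr)
  simp only [Real.sqrt_sq (norm_nonneg _)] at h
  refine h.congr_fderiv ?_
  ext v
  simp
  field_simp

theorem hasFDerivAt_polarPhi {p : EuclideanSpace ℝ (Fin 2)} (hp : p ≠ 0) :
    HasFDerivAt polarPhi ((Real.sin (polarPhi p) / ‖p‖ ^ 2) • innerSL ℝ p) p := by
  have hr : ‖p‖ ≠ 0 := norm_ne_zero_iff.2 hp
  have h := (hasFDerivAt_norm_of_ne_zero hp).arctan.const_mul 2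
  rw [show polarPhi = fun q => 2 * Real.arctan ‖q‖ from funext polarPhi_eq_two_mul_arctan]
  refine h.congr_fderiv ?_
  have hsin := sin_polarPhi p
  rw [polarPhi_eq_two_mul_arctan] at hsin
  ext v
  simp only [hsin, smul_smul, smul_apply, smul_eq_mul]
  field_simp

theorem hasFDerivAt_coord_div_norm {p : EuclideanSpace ℝ (Fin 2)} (hp : p ≠ 0) (i : Fin 2) :
    HasFDerivAt (fun q : EuclideanSpace ℝ (Fin 2) => q i / ‖q‖)
      (‖p‖⁻¹ • EuclideanSpace.proj i - (p i / ‖p‖ ^ 3) • innerSL ℝ p) p := by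
  have hr : ‖p‖ ≠ 0 := norm_ne_zero_iff.2 hp
  have h := (EuclideanSpace.proj i : EuclideanSpace ℝ (Fin 2) →L[ℝ] ℝ).hasFDerivAt (x := p) |>.mul
    ((hasDerivAt_inv hr).comp_hasFDerivAt p (hasFDerivAt_norm_of_ne_zero hp))
  refine (h.congr_fderiv ?_).congr_of_eventuallyEq (.of_forall fun q => ?_)
  · ext v
    simp
    field_simp
    ring
  · simp [div_eq_mul_inv]

/-- The parametrization
`P(x,y) = (α(S(φ)) cos θ, α(S(φ)) sin θ, β(S(φ)))` of the surface of revolution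
(where `cos θ = x/|p|`, `sin θ = y/|p|` and `φ = φ(p)`) is conformal: at every `p ≠ 0`
the partial derivatives `∂ₓP` and `∂_yP` are orthogonal and both have squared length
`(α(S(φ(p)))/|p|)²`, i.e. the pullback metric is `e^{2f}(dx² + dy²)` with
`f = ln(α(S(φ))/|p|)`. -/
theorem parametrization_conformal
    (α β S S' : ℝ → ℝ)
    (hα : ContDiff ℝ 1 α) (hβ : ContDiff ℝ 1 β)
    (harc : ∀ σ : ℝ, deriv α σ ^ 2 + deriv β σ ^ 2 = 1)
    (hS : ∀ φ ∈ Set.Ioo (0 : ℝ) π, HasDerivAt S (S' φ) φ)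
    (hode : ∀ φ ∈ Set.Ioo (0 : ℝ) π, S' φ * Real.sin φ = α (S φ))
    (hpos : ∀ φ ∈ Set.Ioo (0 : ℝ) π, 0 < α (S φ))
    (P : EuclideanSpace ℝ (Fin 2) → EuclideanSpace ℝ (Fin 3))
    (hP : ∀ p, P p = e3 (α (S (polarPhi p)) * (p 0 / ‖p‖))
                        (α (S (polarPhi p)) * (p 1 / ‖p‖))
                        (β (S (polarPhi p)))) :
    ∀ p : EuclideanSpace ℝ (Fin 2), p ≠ 0 →
      DifferentiableAt ℝ P p ∧
      @inner ℝ _ _ (fderiv ℝ P p (EuclideanSpace.single 0 1))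
          (fderiv ℝ P p (EuclideanSpace.single 1 1)) = 0 ∧
      ‖fderiv ℝ P p (EuclideanSpace.single 0 1)‖ ^ 2 = (α (S (polarPhi p)) / ‖p‖) ^ 2 ∧
      ‖fderiv ℝ P p (EuclideanSpace.single 1 1)‖ ^ 2 = (α (S (polarPhi p)) / ‖p‖) ^ 2 := by
  intro p hp
  have hr : ‖p‖ ≠ 0 := norm_ne_zero_iff.2 hp
  have hφ := polarPhi_mem_Ioo hp
  have hσ : HasFDerivAt (fun q => S (polarPhi q))
      ((α (S (polarPhi p)) / ‖p‖ ^ 2) • innerSL ℝ p) p := by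
    refine ((hS _ hφ).comp_hasFDerivAt p (hasFDerivAt_polarPhi hp)).congr_fderiv ?_
    rw [smul_smul, ← hode _ hφ, mul_div_assoc]
  have hA := ((hα.differentiable one_ne_zero) (S (polarPhi p))).hasDerivAt.comp_hasFDerivAt p hσ
  have hB := ((hβ.differentiable one_ne_zero) (S (polarPhi p))).hasDerivAt.comp_hasFDerivAt p hσ
  have h0 : HasFDerivAt (fun q => P q 0) _ p :=
    (hA.mul (hasFDerivAt_coord_div_norm hp 0)).congr_of_eventuallyEq
      (.of_forall fun q => by simp [hP, e3])
  have h1 : HasFDerivAt (fun q => P q 1) _ p :=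
    (hA.mul (hasFDerivAt_coord_div_norm hp 1)).congr_of_eventuallyEq
      (.of_forall fun q => by simp [hP, e3])
  have h2 : HasFDerivAt (fun q => P q 2) _ p :=
    hB.congr_of_eventuallyEq (.of_forall fun q => by simp [hP, e3])
  have hd : DifferentiableAt ℝ P p := by
    rw [differentiableAt_euclidean]
    intro i
    fin_cases i
    exacts [h0.differentiableAt, h1.differentiableAt, h2.differentiableAt]
  have hcoord (i : Fin 3) : HasFDerivAt (fun q => P q i)
      ((EuclideanSpace.proj i).comp (fderiv ℝ P p)) p :=
    (EuclideanSpace.proj i : EuclideanSpace ℝ (Fin 3) →L[ℝ] ℝ).hasFDerivAt.comp p hd.hasFDerivAt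
  have e0 (v) := DFunLike.congr_fun ((hcoord 0).unique h0) v
  have e1 (v) := DFunLike.congr_fun ((hcoord 1).unique h1) v
  have e2 (v) := DFunLike.congr_fun ((hcoord 2).unique h2) v
  simp only [ContinuousLinearMap.comp_apply, PiLp.proj_apply,
    add_apply, sub_apply,
    smul_apply, smul_eq_mul, innerSL_apply_apply, Function.comp_apply]
    at e0 e1 e2
  have hn : ‖p‖ ^ 2 = p 0 ^ 2 + p 1 ^ 2 := by
    simp [EuclideanSpace.norm_sq_eq, Fin.sum_univ_two]
  have hAB := harc (S (polarPhi p))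
  obtain ⟨u, hu⟩ : ∃ u, p 0 = u * ‖p‖ := ⟨p 0 / ‖p‖, by field_simp⟩
  obtain ⟨w, hw⟩ : ∃ w, p 1 = w * ‖p‖ := ⟨p 1 / ‖p‖, by field_simp⟩
  have huw : u ^ 2 + w ^ 2 = 1 := by
    rw [hu, hw] at hn
    refine mul_right_cancel₀ (pow_ne_zero 2 hr) ?_
    linear_combination -hn
  generalize deriv α (S (polarPhi p)) = A at *
  generalize deriv β (S (polarPhi p)) = B at *
  generalize α (S (polarPhi p)) = a at *
  refine ⟨hd, ?_, ?_, ?_⟩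
  · simp [PiLp.inner_apply, Fin.sum_univ_three, e0, e1, e2, hu, hw]
    field_simp
    linear_combination a ^ 2 * u * w * (hAB + (A - 1) ^ 2 * huw)
  · rw [← real_inner_self_eq_norm_sq, PiLp.inner_apply]
    simp [PiLp.inner_apply, Fin.sum_univ_three, e0, e1, e2, hu, hw]
    field_simp
    linear_combination a ^ 2 * u ^ 2 * (hAB + (A - 1) ^ 2 * huw)
  · rw [← real_inner_self_eq_norm_sq, PiLp.inner_apply]
    simp [PiLp.inner_apply, Fin.sum_univ_three, e0, e1, e2, hu, hw]
    field_simp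
    linear_combination a ^ 2 * w ^ 2 * (hAB + (A - 1) ^ 2 * huw)
end

section
/- Let a₁, a₂ > 0, b₁, b₂ ∈ ℝ, and let r₁, r₂ > 0 with r₁ ≠ r₂ satisfy the compatibility equation −(r₁/a₁²)[ (1 − b₁)/r₁ − 2/(r₁ − r₂) ] = (r₂/a₂²)[ (1 − b₂)/r₂ + 2/(r₁ − r₂) ]. Then there exists ω₀ ∈ ℝ such that the curves p₁(t) = r₁(cos ω₀ t, sin ω₀ t) and p₂(t) = r₂(cos ω₀ t, sin ω₀ t) satisfy, for all t ∈ ℝ, the point-vortex system d₁ p₁'(t) = (|p₁|²/a₁²)[ (1 − b₁) p₁^⊥/|p₁|² + 2 d₁ d₂ (p₁ − p₂)^⊥/|p₁ − p₂|² ] and d₂ p₂'(t) = (|p₂|²/a₂²)[ (1 − b₂) p₂^⊥/|p₂|² + 2 d₂ d₁ (p₂ − p₁)^⊥/|p₂ − p₁|² ], where d₁ = 1 and d₂ = −1. -/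
open Real

/-- A point of `ℝ²` (Euclidean). -/
noncomputable def e2 (x y : ℝ) : EuclideanSpace ℝ (Fin 2) :=
  (WithLp.equiv 2 (Fin 2 → ℝ)).symm ![x, y]

/-- The rotation `p^⊥ = (−y, x)` of `p = (x, y) ∈ ℝ²`. -/
noncomputable def perp (p : EuclideanSpace ℝ (Fin 2)) : EuclideanSpace ℝ (Fin 2) :=
  e2 (-(p 1)) (p 0)

@[simp] lemma e2_apply_zero (x y : ℝ) : e2 x y 0 = x := rfl

@[simp] lemma e2_apply_one (x y : ℝ) : e2 x y 1 = y := rfl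

lemma e2_mul_eq_smul (r x y : ℝ) : e2 (r * x) (r * y) = r • e2 x y := by
  ext i
  fin_cases i <;> simp

lemma perp_smul (r : ℝ) (p : EuclideanSpace ℝ (Fin 2)) : perp (r • p) = r • perp p := by
  ext i
  fin_cases i <;> simp [perp]

lemma norm_e2_cos_sin (θ : ℝ) : ‖e2 (cos θ) (sin θ)‖ = 1 := by
  simp [EuclideanSpace.norm_eq, Fin.sum_univ_two]

lemma norm_smul_e2_cos_sin_sq (r θ : ℝ) : ‖r • e2 (cos θ) (sin θ)‖ ^ 2 = r ^ 2 := by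
  rw [norm_smul, norm_e2_cos_sin, mul_one, norm_eq_abs, sq_abs]

/-- The velocity of a uniformly rotating point is `ω` times the rotated position. -/
lemma hasDerivAt_smul_e2_cos_sin (r ω t : ℝ) :
    HasDerivAt (fun s => r • e2 (cos (ω * s)) (sin (ω * s)))
      ((r * ω) • perp (e2 (cos (ω * t)) (sin (ω * t)))) t := by
  have hω : HasDerivAt (fun s => ω * s) ω t := by
    simpa using (hasDerivAt_id t).const_mul ω
  rw [mul_smul]
  refine HasDerivAt.const_smul r ?_
  have h : HasDerivAt (fun s => ![cos (ω * s), sin (ω * s)])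
      (ω • ![-sin (ω * t), cos (ω * t)]) t := by
    rw [hasDerivAt_pi]
    intro i
    fin_cases i
    · simpa [mul_comm] using hω.cos
    · simpa [mul_comm] using hω.sin
  exact (PiLp.hasFDerivAt_toLp (𝕜 := ℝ) 2 _).comp_hasDerivAt t h

/-- If the radii `r₁ ≠ r₂` satisfy the compatibility equation
`−(r₁/a₁²)[(1 − b₁)/r₁ − 2/(r₁ − r₂)] = (r₂/a₂²)[(1 − b₂)/r₂ + 2/(r₁ − r₂)]`,
then there is an angular speed `ω₀` such that the uniformly rotating circular curves
`p₁(t) = r₁(cos ω₀t, sin ω₀t)`, `p₂(t) = r₂(cos ω₀t, sin ω₀t)` solve the generalized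
two-vortex problem with degrees `d₁ = 1`, `d₂ = −1`. -/
theorem rotating_two_vortex_solution
    (a₁ a₂ b₁ b₂ r₁ r₂ : ℝ) (ha₁ : 0 < a₁) (ha₂ : 0 < a₂)
    (hr₁ : 0 < r₁) (hr₂ : 0 < r₂) (hne : r₁ ≠ r₂)
    (d₁ d₂ : ℝ) (hd₁ : d₁ = 1) (hd₂ : d₂ = -1)
    (hcompat : -(r₁ / a₁ ^ 2) * ((1 - b₁) / r₁ - 2 / (r₁ - r₂))
      = (r₂ / a₂ ^ 2) * ((1 - b₂) / r₂ + 2 / (r₁ - r₂))) :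
    ∃ ω₀ : ℝ, ∀ p₁ p₂ : ℝ → EuclideanSpace ℝ (Fin 2),
      (∀ t, p₁ t = e2 (r₁ * Real.cos (ω₀ * t)) (r₁ * Real.sin (ω₀ * t))) →
      (∀ t, p₂ t = e2 (r₂ * Real.cos (ω₀ * t)) (r₂ * Real.sin (ω₀ * t))) →
      ∀ t : ℝ,
        d₁ • deriv p₁ t = (‖p₁ t‖ ^ 2 / a₁ ^ 2) •
            (((1 - b₁) / ‖p₁ t‖ ^ 2) • perp (p₁ t)
              + (2 * d₁ * d₂ / ‖p₁ t - p₂ t‖ ^ 2) • perp (p₁ t - p₂ t)) ∧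
        d₂ • deriv p₂ t = (‖p₂ t‖ ^ 2 / a₂ ^ 2) •
            (((1 - b₂) / ‖p₂ t‖ ^ 2) • perp (p₂ t)
              + (2 * d₂ * d₁ / ‖p₂ t - p₁ t‖ ^ 2) • perp (p₂ t - p₁ t)) := by
  subst hd₁ hd₂
  refine ⟨(r₁ / a₁ ^ 2) * ((1 - b₁) / r₁ - 2 / (r₁ - r₂)), ?_⟩
  set ω := (r₁ / a₁ ^ 2) * ((1 - b₁) / r₁ - 2 / (r₁ - r₂)) with hω
  have hω' : -ω = (r₂ / a₂ ^ 2) * ((1 - b₂) / r₂ + 2 / (r₁ - r₂)) := by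
    rw [← hcompat, hω, neg_mul]
  intro p₁ p₂ hp₁ hp₂ t
  simp only [e2_mul_eq_smul] at hp₁ hp₂
  have hsub : r₁ - r₂ ≠ 0 := sub_ne_zero.mpr hne
  have hsub' : r₂ - r₁ ≠ 0 := sub_ne_zero.mpr hne.symm
  have hd₁ : deriv p₁ t = (r₁ * ω) • perp (e2 (cos (ω * t)) (sin (ω * t))) := by
    rw [funext hp₁]
    exact (hasDerivAt_smul_e2_cos_sin r₁ ω t).deriv
  have hd₂ : deriv p₂ t = (r₂ * ω) • perp (e2 (cos (ω * t)) (sin (ω * t))) := by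
    rw [funext hp₂]
    exact (hasDerivAt_smul_e2_cos_sin r₂ ω t).deriv
  rw [hd₁, hd₂, hp₁, hp₂, ← sub_smul, ← sub_smul]
  simp only [norm_smul_e2_cos_sin_sq, perp_smul, smul_smul, ← add_smul]
  constructor
  · congr 1
    rw [hω]
    field_simp
    ring
  · congr 1
    rw [show -1 * (r₂ * ω) = r₂ * -ω by ring, hω', ← neg_sub r₂ r₁]
    field_simp
end

section
/- Let l > 0 and let α : [0, l] → ℝ be continuously differentiable with α(s) > 0 for s ∈ (0, l) and α(s) = α(l − s) for all s (so the surface of revolution is symmetric about the X-Y plane). Let S : (0, π) → (0, l) be differentiable with S'(φ)·sin φ = α(S(φ)) for all φ ∈ (0, π), and assume S(π − φ) = l − S(φ) for all φ ∈ (0, π). Define φ(p) = arccos((1 − |p|²)/(1 + |p|²)). Then for every integer n ≥ 1 and every r₁ > 0 with r₁ ≠ 1, setting r₂ = 1/r₁, Θ_i = 2π(i−1)/n, d_i = 1 for 1 ≤ i ≤ n and d_i = −1 for n+1 ≤ i ≤ 2n, there exists ω₀ ∈ ℝ such that the curves p_i(t) = r₁(cos(Θ_i + ω₀ t), sin(Θ_i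 + ω₀ t)) for 1 ≤ i ≤ n and p_i(t) = r₂(cos(Θ_{i−n} + ω₀ t), sin(Θ_{i−n} + ω₀ t)) for n+1 ≤ i ≤ 2n satisfy, for all t ∈ ℝ and all 1 ≤ i ≤ 2n, the generalized point-vortex system d_i p_i'(t) = (|p_i|² / α(S(φ(p_i)))²) [ (1 − α'(S(φ(p_i)))) p_i^⊥/|p_i|² + 2 Σ_{j ≠ i} d_i d_j (p_i − p_j)^⊥/|p_i − p_j|² ]. -/
open Real

lemma orthonormalBasisOneI_repr (z : ℂ) :
    Complex.orthonormalBasisOneI.repr z = e2 z.re z.im := by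
  ext i; fin_cases i <;> simp [e2]

lemma perp_repr (z : ℂ) :
    perp (Complex.orthonormalBasisOneI.repr z) =
      Complex.orthonormalBasisOneI.repr (Complex.I * z) := by
  simp [perp, orthonormalBasisOneI_repr, e2]

/-- The logarithmic derivative of `X ^ n - b ^ n`. -/
lemma sum_inv_sub_mul_rootsOfUnity {n : ℕ} (hn : 1 ≤ n) {z b : ℂ} (h : z ^ n ≠ b ^ n) :
    ∑ ξ ∈ Polynomial.nthRootsFinset n (1 : ℂ), (z - b * ξ)⁻¹ =
      n * z ^ (n - 1) / (z ^ n - b ^ n) := by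
  have hp := Complex.isPrimitiveRoot_exp n (by omega)
  have hd : z ^ n - b ^ n ≠ 0 := sub_ne_zero.2 h
  have hprod : ∀ x : ℂ, x ^ n - b ^ n = ∏ ξ ∈ Polynomial.nthRootsFinset n (1 : ℂ), (x - b * ξ) := by
    intro x
    rw [hp.pow_sub_pow_eq_prod_sub_mul _ _ (by omega)]
    simp only [mul_comm]
  have hne : ∀ ξ ∈ Polynomial.nthRootsFinset n (1 : ℂ), z - b * ξ ≠ 0 := by
    rw [hprod] at hd
    exact Finset.prod_ne_zero_iff.1 hd
  have h1 : logDeriv (fun x : ℂ => ∏ ξ ∈ Polynomial.nthRootsFinset n (1 : ℂ), (x - b * ξ)) z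
      = ∑ ξ ∈ Polynomial.nthRootsFinset n (1 : ℂ), (z - b * ξ)⁻¹ := by
    rw [logDeriv_prod]
    · simp [logDeriv_apply]
    · exact hne
    · intros; fun_prop
  rw [← h1, ← funext hprod]
  simp [logDeriv_apply]

/-- Since `1 / (ζ - ξ) + 1 / (ζ - ζ ^ 2 / ξ) = 1 / ζ`, the involution `ξ ↦ ζ ^ 2 / ξ` evaluates
the sum. The term `ξ = ζ` is zero. -/
lemma sum_inv_sub_rootsOfUnity {n : ℕ} (hn : 1 ≤ n) {ζ : ℂ}
    (hζ : ζ ∈ Polynomial.nthRootsFinset n (1 : ℂ)) :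
    ∑ ξ ∈ Polynomial.nthRootsFinset n (1 : ℂ), (ζ - ξ)⁻¹ = (n - 1) / 2 / ζ := by
  have hp := Complex.isPrimitiveRoot_exp n (by omega)
  have hcard := hp.card_nthRootsFinset
  set R := Polynomial.nthRootsFinset n (1 : ℂ)
  have hmem : ∀ ξ, ξ ∈ R ↔ ξ ^ n = 1 := fun ξ => Polynomial.mem_nthRootsFinset (by omega) _
  have hne : ∀ ξ ∈ R, ξ ≠ 0 := by
    rintro ξ hξ rfl
    simp [hmem, show n ≠ 0 by omega] at hξ
  have hζ0 := hne ζ hζ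
  have hinv : ∑ ξ ∈ R, (ζ - ξ)⁻¹ = ∑ ξ ∈ R, (ζ - ζ ^ 2 / ξ)⁻¹ := by
    have hmaps : ∀ ξ ∈ R, ζ ^ 2 / ξ ∈ R := by
      intro ξ hξ
      rw [hmem] at *
      rw [div_pow, ← pow_mul, mul_comm 2 n, pow_mul, hζ, hξ]; simp
    have hinvol : ∀ ξ ∈ R, ζ ^ 2 / (ζ ^ 2 / ξ) = ξ := by
      intro ξ hξ
      have := hne ξ hξ
      field_simp
    refine Finset.sum_bij' (fun ξ _ => ζ ^ 2 / ξ) (fun ξ _ => ζ ^ 2 / ξ) hmaps hmaps hinvol hinvol ?_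
    intro ξ hξ
    simp only [hinvol ξ hξ]
  have hpair : ∀ ξ ∈ R, (ζ - ξ)⁻¹ + (ζ - ζ ^ 2 / ξ)⁻¹ = 1 / ζ - if ξ = ζ then 1 / ζ else 0 := by
    intro ξ hξ
    have h0 := hne ξ hξ
    split_ifs with h
    · subst h; field_simp; simp
    · have h1 : ζ - ξ ≠ 0 := sub_ne_zero.2 (Ne.symm h)
      have h2 : ζ - ζ ^ 2 / ξ = -(ζ * (ζ - ξ)) / ξ := by field_simp; ring
      rw [h2]
      field_simp
      ring
  have htwo : ∑ ξ ∈ R, (ζ - ξ)⁻¹ + ∑ ξ ∈ R, (ζ - ξ)⁻¹ = (n - 1) / ζ := by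
    nth_rw 2 [hinv]
    rw [← Finset.sum_add_distrib, Finset.sum_congr rfl hpair, Finset.sum_sub_distrib,
      Finset.sum_ite_eq' R ζ, if_pos hζ, Finset.sum_const, hcard, nsmul_eq_mul]
    ring
  linear_combination htwo / 2

lemma sum_Icc_exp {n : ℕ} (hn : 1 ≤ n) (f : ℂ → ℂ) :
    ∑ j ∈ Finset.Icc 1 n, f (Complex.exp ((2 * π * ((j : ℝ) - 1) / n : ℝ) * Complex.I)) =
      ∑ ξ ∈ Polynomial.nthRootsFinset n (1 : ℂ), f ξ := by
  have hp := Complex.isPrimitiveRoot_exp n (by omega)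
  have hcast : ∀ j ∈ Finset.Icc 1 n, Complex.exp ((2 * π * ((j : ℝ) - 1) / n : ℝ) * Complex.I) =
      Complex.exp (2 * π * Complex.I / n) ^ (j - 1) := by
    intro j hj
    rw [← Complex.exp_nat_mul, Nat.cast_sub (Finset.mem_Icc.1 hj).1]
    push_cast
    ring_nf
  rw [Finset.sum_congr rfl fun j hj => congrArg f (hcast j hj)]
  have hinj : Set.InjOn (fun j => Complex.exp (2 * π * Complex.I / n) ^ (j - 1))
      (Finset.Icc 1 n : Finset ℕ) := by
    intro a ha b hb hab
    simp only [Finset.coe_Icc, Set.mem_Icc] at ha hb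
    have := hp.pow_inj (by omega) (by omega) hab
    omega
  rw [← Finset.sum_image (f := f) hinj]
  congr 1
  refine Finset.eq_of_subset_of_card_le ?_ ?_
  · intro ξ hξ
    obtain ⟨j, -, rfl⟩ := Finset.mem_image.1 hξ
    rw [Polynomial.mem_nthRootsFinset (by omega), ← pow_mul, mul_comm (j - 1), pow_mul, hp.pow_eq_one,
      one_pow]
  · rw [Finset.card_image_of_injOn hinj, hp.card_nthRootsFinset]
    simp

lemma exp_mem_nthRootsFinset {n : ℕ} (hn : 1 ≤ n) {j : ℕ} :
    Complex.exp ((2 * π * ((j : ℝ) - 1) / n : ℝ) * Complex.I) ∈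
      Polynomial.nthRootsFinset n (1 : ℂ) := by
  have hn0 : (n : ℂ) ≠ 0 := by exact_mod_cast (by omega : n ≠ 0)
  rw [Polynomial.mem_nthRootsFinset (by omega), ← Complex.exp_nat_mul, Complex.exp_eq_one_iff]
  refine ⟨(j : ℤ) - 1, ?_⟩
  push_cast
  field_simp

/-- The sums of reciprocals over two concentric regular `n`-gons that govern the interaction of the
vertex `r * e * ζ` of the first with all other vertices of both. -/
lemma sum_inv_sub_concentric {n : ℕ} (hn : 1 ≤ n) {r s : ℝ} (hr : 0 < r) (hs : 0 < s)
    (hrs : r ≠ s) {e ζ : ℂ} (he : e ≠ 0) (hζ : ζ ∈ Polynomial.nthRootsFinset n (1 : ℂ)) :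
    ∑ ξ ∈ Polynomial.nthRootsFinset n (1 : ℂ), (r * e * ζ - r * e * ξ)⁻¹ -
        ∑ ξ ∈ Polynomial.nthRootsFinset n (1 : ℂ), (r * e * ζ - s * e * ξ)⁻¹ =
      (((n - 1) / 2 - n * r ^ n / (r ^ n - s ^ n) : ℝ) : ℂ) * (r * e * ζ)⁻¹ := by
  have hζn := (Polynomial.mem_nthRootsFinset (by omega) _).1 hζ
  have hζ0 : ζ ≠ 0 := by
    rintro rfl
    simp [show n ≠ 0 by omega] at hζn
  have hr0 : (r : ℂ) ≠ 0 := by exact_mod_cast hr.ne'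
  have hpow : (r : ℂ) ^ n - (s : ℂ) ^ n ≠ 0 := by
    rw [sub_ne_zero]
    exact_mod_cast fun h => hrs ((pow_left_inj₀ hr.le hs.le (by omega)).1 h)
  have hzn : (r * e * ζ) ^ n - (s * e) ^ n = ((r : ℂ) ^ n - s ^ n) * e ^ n := by
    rw [mul_pow, hζn]; ring
  have hen : e ^ n ≠ 0 := pow_ne_zero _ he
  have hne : (r * e * ζ) ^ n ≠ (s * e) ^ n := by
    rw [← sub_ne_zero, hzn]
    exact mul_ne_zero hpow hen
  rw [sum_inv_sub_mul_rootsOfUnity hn hne, hzn]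
  simp only [← mul_sub, mul_inv]
  rw [← Finset.mul_sum, sum_inv_sub_rootsOfUnity hn hζ]
  have hsucc : (r * e * ζ) ^ (n - 1) = r ^ n * e ^ n * ((r : ℂ)⁻¹ * e⁻¹ * ζ⁻¹) := by
    have : (r * e * ζ) ^ (n - 1) * (r * e * ζ) = r ^ n * e ^ n := by
      rw [← pow_succ, Nat.sub_add_cancel hn, mul_pow, hζn]; ring
    rw [← this]
    field_simp
  rw [hsucc]
  push_cast
  field_simp

lemma inv_sq_smul_perp_repr (z : ℂ) :
    (1 / ‖Complex.orthonormalBasisOneI.repr z‖ ^ 2) •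
        perp (Complex.orthonormalBasisOneI.repr z) =
      Complex.orthonormalBasisOneI.repr (Complex.I * (starRingEnd ℂ) z⁻¹) := by
  rw [perp_repr, LinearIsometryEquiv.norm_map, ← map_smul, Complex.inv_def,
    ← Complex.normSq_eq_norm_sq, map_mul (starRingEnd ℂ), Complex.conj_conj,
    Complex.conj_ofReal, Complex.real_smul]
  push_cast
  ring_nf

/-- The field induced at a vertex of a regular `n`-gon of radius `r` by the other vertices and by
vortices of opposite sign on a concentric aligned `n`-gon of radius `s`. -/
lemma two_ring_interaction {n : ℕ} (hn : 1 ≤ n) {r s : ℝ} (hr : 0 < r) (hs : 0 < s)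
    (hrs : r ≠ s) {e ζ : ℂ} (he : e ≠ 0) (hζ : ζ ∈ Polynomial.nthRootsFinset n (1 : ℂ))
    {P : EuclideanSpace ℝ (Fin 2)} {z w : ℕ → EuclideanSpace ℝ (Fin 2)}
    (hP : P = Complex.orthonormalBasisOneI.repr (r * e * ζ))
    (hz : ∀ j ∈ Finset.Icc 1 n, z j = Complex.orthonormalBasisOneI.repr
      (r * e * Complex.exp ((2 * π * ((j : ℝ) - 1) / n : ℝ) * Complex.I)))
    (hw : ∀ j ∈ Finset.Icc 1 n, w j = Complex.orthonormalBasisOneI.repr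
      (s * e * Complex.exp ((2 * π * ((j : ℝ) - 1) / n : ℝ) * Complex.I))) :
    ∑ j ∈ Finset.Icc 1 n, (1 / ‖P - z j‖ ^ 2) • perp (P - z j) -
        ∑ j ∈ Finset.Icc 1 n, (1 / ‖P - w j‖ ^ 2) • perp (P - w j) =
      (((n - 1) / 2 - n * r ^ n / (r ^ n - s ^ n)) / ‖P‖ ^ 2) • perp P := by
  have hring : ∀ (a : ℝ) (v : ℕ → EuclideanSpace ℝ (Fin 2)),
      (∀ j ∈ Finset.Icc 1 n, v j = Complex.orthonormalBasisOneI.repr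
        (a * e * Complex.exp ((2 * π * ((j : ℝ) - 1) / n : ℝ) * Complex.I))) →
      ∑ j ∈ Finset.Icc 1 n, (1 / ‖P - v j‖ ^ 2) • perp (P - v j) =
        Complex.orthonormalBasisOneI.repr (Complex.I * (starRingEnd ℂ)
          (∑ ξ ∈ Polynomial.nthRootsFinset n (1 : ℂ), (r * e * ζ - a * e * ξ)⁻¹)) := by
    intro a v hv
    rw [← sum_Icc_exp hn fun ξ => (r * e * ζ - a * e * ξ)⁻¹, map_sum, Finset.mul_sum, map_sum]
    refine Finset.sum_congr rfl fun j hj => ?_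
    rw [hP, hv j hj, ← map_sub, inv_sq_smul_perp_repr]
  rw [hring r z hz, hring s w hw, ← map_sub, ← mul_sub, ← map_sub,
    sum_inv_sub_concentric hn hr hs hrs he hζ, map_mul (starRingEnd ℂ), Complex.conj_ofReal, mul_left_comm,
    ← Complex.real_smul, map_smul, hP, ← inv_sq_smul_perp_repr, smul_smul]
  congr 1
  ring

lemma e2_polar (r θ φ : ℝ) :
    e2 (r * cos (θ + φ)) (r * sin (θ + φ)) = Complex.orthonormalBasisOneI.repr
      (r * Complex.exp (φ * Complex.I) * Complex.exp (θ * Complex.I)) := by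
  rw [orthonormalBasisOneI_repr, mul_assoc, ← Complex.exp_add, ← add_mul, ← Complex.ofReal_add,
    Complex.re_ofReal_mul, Complex.im_ofReal_mul, Complex.exp_ofReal_mul_I_re,
    Complex.exp_ofReal_mul_I_im, add_comm φ]

lemma norm_e2_polar {r : ℝ} (hr : 0 < r) (θ : ℝ) : ‖e2 (r * cos θ) (r * sin θ)‖ = r := by
  have h := e2_polar r θ 0
  rw [add_zero] at h
  rw [h, LinearIsometryEquiv.norm_map]
  simp [Complex.norm_exp_ofReal_mul_I, abs_of_pos hr]

lemma deriv_e2_polar (r θ ω t : ℝ) :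
    deriv (fun t => e2 (r * cos (θ + ω * t)) (r * sin (θ + ω * t))) t =
      ω • perp (e2 (r * cos (θ + ω * t)) (r * sin (θ + ω * t))) := by
  simp only [e2_polar, perp_repr, ← map_smul]
  have h : HasDerivAt (fun t : ℝ => (r * Complex.exp ((ω * t : ℝ) * Complex.I) *
      Complex.exp (θ * Complex.I) : ℂ)) (ω • (Complex.I * (r * Complex.exp ((ω * t : ℝ) * Complex.I) *
      Complex.exp (θ * Complex.I)))) t := by
    have h1 : HasDerivAt (fun t : ℝ => ((ω * t : ℝ) : ℂ) * Complex.I) (ω * Complex.I) t := by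
      have := ((hasDerivAt_id t).const_mul ω).ofReal_comp.mul_const Complex.I
      simpa using this
    refine ((h1.cexp.const_mul (r : ℂ)).mul_const (Complex.exp (θ * Complex.I))).congr_deriv ?_
    rw [Complex.real_smul]
    ring
  exact (Complex.orthonormalBasisOneI.repr.toContinuousLinearEquiv.toContinuousLinearMap.hasFDerivAt
    |>.comp_hasDerivAt t h).deriv

lemma arccos_mem_Ioo {r : ℝ} (hr : 0 < r) :
    arccos ((1 - r ^ 2) / (1 + r ^ 2)) ∈ Set.Ioo (0 : ℝ) π := by
  have h : 0 < 1 + r ^ 2 := by positivity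
  have h2 : 0 < r ^ 2 := by positivity
  refine ⟨arccos_pos.2 ((div_lt_one h).2 (by linarith)), ?_⟩
  refine lt_of_le_of_ne (arccos_le_pi _) fun h' => ?_
  rw [arccos_eq_pi, div_le_iff₀ h] at h'
  linarith

lemma arccos_one_div {r : ℝ} (hr : 0 < r) :
    arccos ((1 - (1 / r) ^ 2) / (1 + (1 / r) ^ 2)) =
      π - arccos ((1 - r ^ 2) / (1 + r ^ 2)) := by
  rw [← arccos_neg]
  congr 1
  field_simp
  ring

lemma sum_Icc_two_mul {M : Type*} [AddCommMonoid M] (n : ℕ) (f : ℕ → M) :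
    ∑ j ∈ Finset.Icc 1 (2 * n), f j =
      ∑ j ∈ Finset.Icc 1 n, f j + ∑ j ∈ Finset.Icc 1 n, f (j + n) := by
  have h : Finset.Icc 1 (2 * n) = Finset.Icc 1 n ∪ Finset.Icc (1 + n) (n + n) := by
    ext j
    simp only [Finset.mem_union, Finset.mem_Icc]
    omega
  rw [h, Finset.sum_union, ← Finset.map_add_right_Icc, Finset.sum_map]
  · rfl
  · rw [Finset.disjoint_left]
    intro j
    simp only [Finset.mem_Icc]
    omega

/-- Proposition 1 of the paper, in the planar conformal chart.
On a surface of revolution symmetric about the X–Y plane (`α(s) = α(l − s)`, with the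
conformal latitude function satisfying `S(π − φ) = l − S(φ)`), for every `n ≥ 1` and every
radius `r₁ ≠ 1`, taking `r₂ = 1/r₁` (the symmetric radius), there is an angular speed `ω₀`
such that the two rings of `n` equally spaced vortices of degrees `±1` rotating at speed
`ω₀` solve the generalized point-vortex system
`d_i p_i' = (|p_i|²/α(S(φ(p_i)))²)[(1 − α'(S(φ(p_i)))) p_i^⊥/|p_i|²
  + 2 Σ_{j≠i} d_i d_j (p_i − p_j)^⊥/|p_i − p_j|²]`. -/
theorem rotating_two_ring_solution_symmetric_surface
    (l : ℝ) (hl : 0 < l) (α S S' : ℝ → ℝ)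
    (hα : ContDiff ℝ 1 α)
    (hαpos : ∀ s ∈ Set.Ioo 0 l, 0 < α s)
    (hαsym : ∀ s : ℝ, α s = α (l - s))
    (hmaps : ∀ φ ∈ Set.Ioo (0 : ℝ) π, S φ ∈ Set.Ioo 0 l)
    (hS : ∀ φ ∈ Set.Ioo (0 : ℝ) π, HasDerivAt S (S' φ) φ)
    (hode : ∀ φ ∈ Set.Ioo (0 : ℝ) π, S' φ * Real.sin φ = α (S φ))
    (hSsym : ∀ φ ∈ Set.Ioo (0 : ℝ) π, S (π - φ) = l - S φ)
    (n : ℕ) (hn : 1 ≤ n)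
    (r₁ r₂ : ℝ) (hr₁ : 0 < r₁) (hr₁ne : r₁ ≠ 1) (hr₂ : r₂ = 1 / r₁)
    (Θ : ℕ → ℝ) (hΘ : ∀ i, Θ i = 2 * π * ((i : ℝ) - 1) / n)
    (d : ℕ → ℝ) (hd : ∀ i, d i = if i ≤ n then 1 else -1) :
    ∃ ω₀ : ℝ, ∀ p : ℕ → ℝ → EuclideanSpace ℝ (Fin 2),
      (∀ i ∈ Finset.Icc 1 n, ∀ t : ℝ,
        p i t = e2 (r₁ * Real.cos (Θ i + ω₀ * t)) (r₁ * Real.sin (Θ i + ω₀ * t))) →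
      (∀ i ∈ Finset.Icc (n + 1) (2 * n), ∀ t : ℝ,
        p i t = e2 (r₂ * Real.cos (Θ (i - n) + ω₀ * t)) (r₂ * Real.sin (Θ (i - n) + ω₀ * t))) →
      ∀ t : ℝ, ∀ i ∈ Finset.Icc 1 (2 * n),
        d i • deriv (p i) t = (‖p i t‖ ^ 2 / (α (S (polarPhi (p i t)))) ^ 2) •
          (((1 - deriv α (S (polarPhi (p i t)))) / ‖p i t‖ ^ 2) • perp (p i t)
            + (2 : ℝ) • ∑ j ∈ (Finset.Icc 1 (2 * n)).erase i,
                ((d i * d j) / ‖p i t - p j t‖ ^ 2) • perp (p i t - p j t)) := by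
  have hr₂pos : 0 < r₂ := by rw [hr₂]; positivity
  have hne : r₁ ≠ r₂ := by
    rintro h
    rw [hr₂, eq_div_iff hr₁.ne'] at h
    exact hr₁ne (by nlinarith)
  set ψ := arccos ((1 - r₁ ^ 2) / (1 + r₁ ^ 2)) with hψ
  have hψmem : ψ ∈ Set.Ioo (0 : ℝ) π := arccos_mem_Ioo hr₁
  have hψ₂ : arccos ((1 - r₂ ^ 2) / (1 + r₂ ^ 2)) = π - ψ := by rw [hr₂, arccos_one_div hr₁]
  have hα₂ : α (S (π - ψ)) = α (S ψ) := by rw [hSsym ψ hψmem, ← hαsym]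
  have hα'₂ : deriv α (S (π - ψ)) = -deriv α (S ψ) := by
    rw [hSsym ψ hψmem, ← neg_eq_iff_eq_neg, ← deriv_comp_const_sub, ← funext hαsym]
  have hA : α (S ψ) ≠ 0 := (hαpos _ (hmaps ψ hψmem)).ne'
  have hpow : r₁ ^ n - r₂ ^ n ≠ 0 :=
    sub_ne_zero.2 fun h => hne ((pow_left_inj₀ hr₁.le hr₂pos.le (by omega)).1 h)
  have hpow' : r₂ ^ n - r₁ ^ n ≠ 0 := by rwa [← neg_sub, neg_ne_zero]
  refine ⟨(1 - deriv α (S ψ) + 2 * ((n - 1) / 2 - n * r₁ ^ n / (r₁ ^ n - r₂ ^ n))) / α (S ψ) ^ 2,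
    fun p hp₁ hp₂ t i hi => ?_⟩
  set ω := (1 - deriv α (S ψ) + 2 * ((n - 1) / 2 - n * r₁ ^ n / (r₁ ^ n - r₂ ^ n))) / α (S ψ) ^ 2
    with hω
  replace hp₂ : ∀ j ∈ Finset.Icc 1 n, ∀ t, p (j + n) t =
      e2 (r₂ * cos (Θ j + ω * t)) (r₂ * sin (Θ j + ω * t)) := by
    intro j hj t
    rw [Finset.mem_Icc] at hj
    rw [hp₂ (j + n) (by rw [Finset.mem_Icc]; omega), Nat.add_sub_cancel]
  have hz : ∀ j ∈ Finset.Icc 1 n, p j t = Complex.orthonormalBasisOneI.repr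
      (r₁ * Complex.exp ((ω * t : ℝ) * Complex.I) *
        Complex.exp ((2 * π * ((j : ℝ) - 1) / n : ℝ) * Complex.I)) := by
    intro j hj
    rw [hp₁ j hj, e2_polar, hΘ]
  have hw : ∀ j ∈ Finset.Icc 1 n, p (j + n) t = Complex.orthonormalBasisOneI.repr
      (r₂ * Complex.exp ((ω * t : ℝ) * Complex.I) *
        Complex.exp ((2 * π * ((j : ℝ) - 1) / n : ℝ) * Complex.I)) := by
    intro j hj
    rw [hp₂ j hj, e2_polar, hΘ]
  have hd₁ : ∀ j ∈ Finset.Icc 1 n, d j = 1 := fun j hj => by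
    rw [hd, if_pos (Finset.mem_Icc.1 hj).2]
  have hd₂ : ∀ j ∈ Finset.Icc 1 n, d (j + n) = -1 := fun j hj => by
    rw [hd, if_neg (by have := (Finset.mem_Icc.1 hj).1; omega)]
  rw [Finset.sum_erase _ (by simp [perp, e2]), sum_Icc_two_mul]
  rcases le_or_gt i n with hin | hin
  · have hi' : i ∈ Finset.Icc 1 n := Finset.mem_Icc.2 ⟨(Finset.mem_Icc.1 hi).1, hin⟩
    have hsum : ∑ j ∈ Finset.Icc 1 n, (d i * d j / ‖p i t - p j t‖ ^ 2) • perp (p i t - p j t) +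
        ∑ j ∈ Finset.Icc 1 n,
          (d i * d (j + n) / ‖p i t - p (j + n) t‖ ^ 2) • perp (p i t - p (j + n) t) =
        (((n - 1) / 2 - n * r₁ ^ n / (r₁ ^ n - r₂ ^ n)) / ‖p i t‖ ^ 2) • perp (p i t) := by
      rw [← two_ring_interaction hn hr₁ hr₂pos hne (Complex.exp_ne_zero _)
        (exp_mem_nthRootsFinset hn) (hz i hi') hz hw, sub_eq_add_neg, ← Finset.sum_neg_distrib]
      refine congrArg₂ _ (Finset.sum_congr rfl fun j hj => ?_) (Finset.sum_congr rfl fun j hj => ?_)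
      · rw [hd₁ i hi', hd₁ j hj, one_mul]
      · rw [hd₁ i hi', hd₂ j hj, one_mul, neg_div, neg_smul]
    have hnorm : ‖p i t‖ = r₁ := by rw [hp₁ i hi', norm_e2_polar hr₁]
    have hderiv : deriv (p i) t = ω • perp (p i t) := by
      rw [funext (hp₁ i hi'), deriv_e2_polar]
    rw [hsum, hderiv, hd₁ i hi', polarPhi, hnorm, ← hψ]
    simp only [smul_smul, ← add_smul]
    congr 1
    rw [hω]
    field_simp
  · obtain ⟨k, rfl⟩ := Nat.exists_eq_add_of_le' hin.le
    have hk : k ∈ Finset.Icc 1 n := by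
      rw [Finset.mem_Icc] at hi ⊢
      omega
    have hsum : ∑ j ∈ Finset.Icc 1 n,
          (d (k + n) * d j / ‖p (k + n) t - p j t‖ ^ 2) • perp (p (k + n) t - p j t) +
        ∑ j ∈ Finset.Icc 1 n, (d (k + n) * d (j + n) / ‖p (k + n) t - p (j + n) t‖ ^ 2) •
          perp (p (k + n) t - p (j + n) t) =
        (((n - 1) / 2 - n * r₂ ^ n / (r₂ ^ n - r₁ ^ n)) / ‖p (k + n) t‖ ^ 2) •
          perp (p (k + n) t) := by
      rw [← two_ring_interaction (z := fun j => p (j + n) t) hn hr₂pos hr₁ hne.symm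
        (Complex.exp_ne_zero _) (exp_mem_nthRootsFinset hn) (hw k hk) hw hz, sub_eq_neg_add,
        ← Finset.sum_neg_distrib]
      refine congrArg₂ _ (Finset.sum_congr rfl fun j hj => ?_) (Finset.sum_congr rfl fun j hj => ?_)
      · rw [hd₂ k hk, hd₁ j hj, mul_one, neg_div, neg_smul]
      · rw [hd₂ k hk, hd₂ j hj, neg_mul_neg, one_mul]
    have hnorm : ‖p (k + n) t‖ = r₂ := by rw [hp₂ k hk, norm_e2_polar hr₂pos]
    have hderiv : deriv (p (k + n)) t = ω • perp (p (k + n) t) := by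
      rw [funext (hp₂ k hk), deriv_e2_polar]
    rw [hsum, hderiv, hd₂ k hk, polarPhi, hnorm, hψ₂, hα₂, hα'₂]
    simp only [smul_smul, ← add_smul]
    congr 1
    have hflip : (n : ℝ) * r₂ ^ n / (r₂ ^ n - r₁ ^ n) =
        n - n * r₁ ^ n / (r₁ ^ n - r₂ ^ n) := by
      field_simp
      ring
    rw [hω, hflip]
    field_simp
    ring
end
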